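/- Let N ≥ 2 and Ω = {(q1,…,qN) ∈ ℝᴺ : 0 < qi < π for i = 2,…,N}. Define recursively on Ω × ℝᴺ: H1 = (1/2)p1², H_i = (1/2)p_i² + (4/sin²(qi))·H_{i−1} for 2 ≤ i ≤ N, and K_i = cos(q_{i−1})·p_i² − 4·sin(q_{i−1})·(cos(qi)/sin(qi))·p_i·p_{i−1} − 8·cos(q_{i−1})·(cos²(qi)/sin²(qi))·H_{i−1} for 2 ≤ i ≤ N. Then for all 2 ≤ i ≤ j ≤ N, {H_j, H_i} = 0 and {H_j, K_i} = 0 at every point of Ω × ℝᴺ. -/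

import Mathlib

open Real

/-- Partial derivative of `F(q,p)` with respect to the coordinate `q i`. -/
noncomputable def pdq (i : ℕ) (F : (ℕ → ℝ) → (ℕ → ℝ) → ℝ) (q p : ℕ → ℝ) : ℝ :=
  deriv (fun t => F (Function.update q i t) p) (q i)

/-- Partial derivative of `F(q,p)` with respect to the momentum `p i`. -/
noncomputable def pdp (i : ℕ) (F : (ℕ → ℝ) → (ℕ → ℝ) → ℝ) (q p : ℕ → ℝ) : ℝ :=
  deriv (fun t => F q (Function.update p i t)) (p i)

/-- Poisson bracket on `ℝᴺ × ℝᴺ` (coordinates labelled `1,…,N`):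
`{F,G} = ∑_{i=1}^{N} (∂F/∂qⁱ ∂G/∂pᵢ − ∂F/∂pᵢ ∂G/∂qⁱ)`. -/
noncomputable def poissonBracket (N : ℕ) (F G : (ℕ → ℝ) → (ℕ → ℝ) → ℝ)
    (q p : ℕ → ℝ) : ℝ :=
  ∑ i ∈ Finset.Icc 1 N, (pdq i F q p * pdp i G q p - pdp i F q p * pdq i G q p)

/-- The hierarchy `H1 = (1/2)p1²`, `H_i = (1/2)pᵢ² + (4/sin²(qⁱ)) H_{i−1}`. -/
noncomputable def Hh : ℕ → (ℕ → ℝ) → (ℕ → ℝ) → ℝ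
  | 0, _, _ => 0
  | 1, _, p => (1/2) * (p 1)^2
  | (i+2), q, p => (1/2) * (p (i+2))^2 + (4/(Real.sin (q (i+2)))^2) * Hh (i+1) q p

/-- The additional quadratic first integrals
`K_i = cos(q^{i−1}) pᵢ² − 4 sin(q^{i−1}) (cos qⁱ/sin qⁱ) pᵢ p_{i−1}
       − 8 cos(q^{i−1}) (cos²qⁱ/sin²qⁱ) H_{i−1}` for `i ≥ 2`. -/
noncomputable def Kk : ℕ → (ℕ → ℝ) → (ℕ → ℝ) → ℝ
  | (i+2), q, p =>
      Real.cos (q (i+1)) * (p (i+2))^2 -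
        4 * Real.sin (q (i+1)) * (Real.cos (q (i+2))/Real.sin (q (i+2))) *
          (p (i+2)) * (p (i+1)) -
        8 * Real.cos (q (i+1)) * ((Real.cos (q (i+2)))^2/(Real.sin (q (i+2)))^2) *
          Hh (i+1) q p
  | _, _, _ => 0

theorem Hh_update_q_of_lt {m k : ℕ} (h : m < k) (q p : ℕ → ℝ) (t : ℝ) :
    Hh m (Function.update q k t) p = Hh m q p := by
  induction m using Nat.twoStepInduction with
  | zero => rfl
  | one => rfl
  | more m _ ih => simp [Hh, ih (by omega), Function.update_of_ne h.ne]

theorem Hh_update_p_of_lt {m k : ℕ} (h : m < k) (q p : ℕ → ℝ) (t : ℝ) :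
    Hh m q (Function.update p k t) = Hh m q p := by
  induction m using Nat.twoStepInduction with
  | zero => rfl
  | one => simp [Hh, Function.update_of_ne h.ne]
  | more m _ ih => simp [Hh, ih (by omega), Function.update_of_ne h.ne]

theorem pdq_Hh_of_lt {m k : ℕ} (h : m < k) (q p : ℕ → ℝ) : pdq k (Hh m) q p = 0 := by
  simp [pdq, Hh_update_q_of_lt h]

theorem pdp_Hh_of_lt {m k : ℕ} (h : m < k) (q p : ℕ → ℝ) : pdp k (Hh m) q p = 0 := by
  simp [pdp, Hh_update_p_of_lt h]

theorem pdq_Kk_of_lt {m k : ℕ} (h : m < k) (q p : ℕ → ℝ) : pdq k (Kk m) q p = 0 := by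
  match m with
  | 0 | 1 => simp [pdq, Kk]
  | m + 2 =>
    simp [pdq, Kk, Hh_update_q_of_lt (show m + 1 < k by omega),
      Function.update_of_ne (show m + 2 ≠ k by omega),
      Function.update_of_ne (show m + 1 ≠ k by omega)]

theorem pdp_Kk_of_lt {m k : ℕ} (h : m < k) (q p : ℕ → ℝ) : pdp k (Kk m) q p = 0 := by
  match m with
  | 0 | 1 => simp [pdp, Kk]
  | m + 2 =>
    simp [pdp, Kk, Hh_update_p_of_lt (show m + 1 < k by omega),
      Function.update_of_ne (show m + 2 ≠ k by omega),
      Function.update_of_ne (show m + 1 ≠ k by omega)]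

theorem pdq_Hh_of_ne {m k : ℕ} (h : k ≠ m + 2) (q p : ℕ → ℝ) :
    pdq k (Hh (m + 2)) q p = 4 / Real.sin (q (m + 2)) ^ 2 * pdq k (Hh (m + 1)) q p := by
  simp [pdq, Hh, Function.update_of_ne h.symm]

theorem pdp_Hh_of_ne {m k : ℕ} (h : k ≠ m + 2) (q p : ℕ → ℝ) :
    pdp k (Hh (m + 2)) q p = 4 / Real.sin (q (m + 2)) ^ 2 * pdp k (Hh (m + 1)) q p := by
  simp [pdp, Hh, Function.update_of_ne h.symm]

theorem hasDerivAt_Hh_q_self {m : ℕ} {q : ℕ → ℝ} (p : ℕ → ℝ) (hs : Real.sin (q (m + 2)) ≠ 0) :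
    HasDerivAt (fun t => Hh (m + 2) (Function.update q (m + 2) t) p)
      (-8 * Real.cos (q (m + 2)) / Real.sin (q (m + 2)) ^ 3 * Hh (m + 1) q p) (q (m + 2)) := by
  simp only [Hh, Hh_update_q_of_lt (show m + 1 < m + 2 by omega), Function.update_self]
  have h := ((((hasDerivAt_const (q (m + 2)) (4 : ℝ)).div
    ((Real.hasDerivAt_sin (q (m + 2))).pow 2) (pow_ne_zero 2 hs)).mul_const
      (Hh (m + 1) q p)).const_add (1 / 2 * p (m + 2) ^ 2))
  refine h.congr_deriv ?_
  simp only [Pi.pow_apply, Nat.cast_ofNat, Nat.add_one_sub_one, pow_one]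
  field_simp
  ring

theorem pdp_Hh_self (m : ℕ) (q p : ℕ → ℝ) : pdp (m + 1) (Hh (m + 1)) q p = p (m + 1) := by
  have h := ((hasDerivAt_pow 2 (p (m + 1))).const_mul (1 / 2 : ℝ))
  cases m with
  | zero =>
    simp only [pdp, Hh, Function.update_self]
    rw [h.deriv]; simp
  | succ m =>
    simp only [pdp, Hh, Function.update_self, Hh_update_p_of_lt (show m + 1 < m + 2 by omega)]
    rw [(h.add_const _).deriv]; simp

/-- The derivative in the last coordinate satisfies the relation that makes `cos` of this
coordinate an admissible extension function. -/
theorem sin_mul_pdq_Hh_self {m : ℕ} {q : ℕ → ℝ} (p : ℕ → ℝ)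
    (hs : 2 ≤ m + 1 → Real.sin (q (m + 1)) ≠ 0) :
    Real.sin (q (m + 1)) * pdq (m + 1) (Hh (m + 1)) q p =
      -2 * Real.cos (q (m + 1)) * (Hh (m + 1) q p - 1 / 2 * p (m + 1) ^ 2) := by
  cases m with
  | zero => simp [pdq, Hh]
  | succ m =>
    have hs := hs (by omega)
    rw [pdq, (hasDerivAt_Hh_q_self p hs).deriv]
    simp only [Hh]
    field_simp
    ring

theorem hasDerivAt_Hh_q_last {m : ℕ} {q : ℕ → ℝ} (p : ℕ → ℝ)
    (hs : 2 ≤ m + 1 → Real.sin (q (m + 1)) ≠ 0) :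
    HasDerivAt (fun t => Hh (m + 1) (Function.update q (m + 1) t) p)
      (pdq (m + 1) (Hh (m + 1)) q p) (q (m + 1)) := by
  refine DifferentiableAt.hasDerivAt ?_
  cases m with
  | zero => simp [Hh]
  | succ m => exact (hasDerivAt_Hh_q_self p (hs (by omega))).differentiableAt

theorem hasDerivAt_Hh_p_last (m : ℕ) (q p : ℕ → ℝ) :
    HasDerivAt (fun t => Hh (m + 1) q (Function.update p (m + 1) t)) (p (m + 1)) (p (m + 1)) := by
  suffices h : DifferentiableAt ℝ (fun t => Hh (m + 1) q (Function.update p (m + 1) t))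
      (p (m + 1)) from h.hasDerivAt.congr_deriv (pdp_Hh_self m q p)
  cases m with
  | zero => simp only [Hh, Function.update_self]; fun_prop
  | succ m =>
    simp only [Hh, Function.update_self, Hh_update_p_of_lt (show m + 1 < m + 2 by omega)]
    fun_prop

theorem poissonBracket_Hh_succ {N m : ℕ} {q : ℕ → ℝ} (p : ℕ → ℝ) (hm : m + 2 ≤ N)
    (hs : Real.sin (q (m + 2)) ≠ 0) (F : (ℕ → ℝ) → (ℕ → ℝ) → ℝ) :
    poissonBracket N (Hh (m + 2)) F q p =
      (-8 * Real.cos (q (m + 2)) / Real.sin (q (m + 2)) ^ 3 * Hh (m + 1) q p *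
        pdp (m + 2) F q p - p (m + 2) * pdq (m + 2) F q p) +
      4 / Real.sin (q (m + 2)) ^ 2 * poissonBracket N (Hh (m + 1)) F q p := by
  have hmem : m + 2 ∈ Finset.Icc 1 N := by simp; omega
  rw [poissonBracket, poissonBracket, ← Finset.add_sum_erase _ _ hmem,
    ← Finset.add_sum_erase _ _ hmem, pdp_Hh_self (m + 1), pdq,
    (hasDerivAt_Hh_q_self p hs).deriv, pdq_Hh_of_lt (show m + 1 < m + 2 by omega),
    pdp_Hh_of_lt (show m + 1 < m + 2 by omega), zero_mul, zero_mul, sub_zero, zero_add,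
    Finset.mul_sum]
  congr 1
  refine Finset.sum_congr rfl fun k hk => ?_
  have hk := Finset.ne_of_mem_erase hk
  rw [pdq_Hh_of_ne hk, pdp_Hh_of_ne hk]
  ring

theorem poissonBracket_Hh_eq_zero_of_le {N i j : ℕ} {q p : ℕ → ℝ}
    {F : (ℕ → ℝ) → (ℕ → ℝ) → ℝ} (hs : ∀ k, 2 ≤ k → k ≤ N → Real.sin (q k) ≠ 0)
    (hi : 2 ≤ i) (hij : i ≤ j) (hj : j ≤ N) (hFq : ∀ k, i < k → pdq k F q p = 0)
    (hFp : ∀ k, i < k → pdp k F q p = 0) (h : poissonBracket N (Hh i) F q p = 0) :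
    poissonBracket N (Hh j) F q p = 0 := by
  induction j, hij using Nat.le_induction with
  | base => exact h
  | succ j hij ih =>
    obtain ⟨m, rfl⟩ : ∃ m, j = m + 1 := ⟨j - 1, by omega⟩
    rw [poissonBracket_Hh_succ p hj (hs _ (by omega) hj), hFq _ (by omega), hFp _ (by omega),
      ih (by omega)]
    ring

section Kk

variable {m : ℕ} {q : ℕ → ℝ} (p : ℕ → ℝ)

theorem pdq_Kk_self (hs : Real.sin (q (m + 2)) ≠ 0) :
    pdq (m + 2) (Kk (m + 2)) q p =
      4 * Real.sin (q (m + 1)) / Real.sin (q (m + 2)) ^ 2 * p (m + 2) * p (m + 1) +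
        16 * Real.cos (q (m + 1)) * Real.cos (q (m + 2)) / Real.sin (q (m + 2)) ^ 3 *
          Hh (m + 1) q p := by
  simp only [pdq, Kk, Function.update_self, Hh_update_q_of_lt (show m + 1 < m + 2 by omega),
    Function.update_of_ne (show m + 1 ≠ m + 2 by omega)]
  have hsin := Real.hasDerivAt_sin (q (m + 2))
  have hcos := Real.hasDerivAt_cos (q (m + 2))
  have h := (((((hcos.div hsin hs).const_mul (4 * Real.sin (q (m + 1)))).mul_const
    (p (m + 2))).mul_const (p (m + 1))).const_sub (Real.cos (q (m + 1)) * p (m + 2) ^ 2)).sub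
    ((((hcos.pow 2).div (hsin.pow 2) (pow_ne_zero 2 hs)).const_mul
      (8 * Real.cos (q (m + 1)))).mul_const (Hh (m + 1) q p))
  refine h.deriv.trans ?_
  simp only [Pi.pow_apply, Nat.cast_ofNat, Nat.add_one_sub_one, pow_one]
  field_simp
  linear_combination (4 * Real.sin (q (m + 1)) * p (m + 2) * p (m + 1) * Real.sin (q (m + 2)) +
    16 * Real.cos (q (m + 1)) * Real.cos (q (m + 2)) * Hh (m + 1) q p) *
      Real.sin_sq_add_cos_sq (q (m + 2))

theorem pdp_Kk_self (q : ℕ → ℝ) :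
    pdp (m + 2) (Kk (m + 2)) q p =
      2 * Real.cos (q (m + 1)) * p (m + 2) -
        4 * Real.sin (q (m + 1)) * (Real.cos (q (m + 2)) / Real.sin (q (m + 2))) * p (m + 1) := by
  simp only [pdp, Kk, Function.update_self, Hh_update_p_of_lt (show m + 1 < m + 2 by omega),
    Function.update_of_ne (show m + 1 ≠ m + 2 by omega)]
  have h := (((hasDerivAt_pow 2 (p (m + 2))).const_mul (Real.cos (q (m + 1)))).sub
    (((hasDerivAt_id (p (m + 2))).const_mul (4 * Real.sin (q (m + 1)) *
      (Real.cos (q (m + 2)) / Real.sin (q (m + 2))))).mul_const (p (m + 1)))).sub_const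
    (8 * Real.cos (q (m + 1)) * (Real.cos (q (m + 2)) ^ 2 / Real.sin (q (m + 2)) ^ 2) *
      Hh (m + 1) q p)
  refine h.deriv.trans ?_
  push_cast
  ring

theorem pdq_Kk_pred (hs : 2 ≤ m + 1 → Real.sin (q (m + 1)) ≠ 0) :
    pdq (m + 1) (Kk (m + 2)) q p =
      (-Real.sin (q (m + 1)) * p (m + 2) ^ 2 -
        4 * Real.cos (q (m + 1)) * (Real.cos (q (m + 2)) / Real.sin (q (m + 2))) *
          p (m + 2) * p (m + 1) +
        8 * Real.sin (q (m + 1)) * (Real.cos (q (m + 2)) ^ 2 / Real.sin (q (m + 2)) ^ 2) *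
          Hh (m + 1) q p) -
      8 * Real.cos (q (m + 1)) * (Real.cos (q (m + 2)) ^ 2 / Real.sin (q (m + 2)) ^ 2) *
        pdq (m + 1) (Hh (m + 1)) q p := by
  rw [pdq]
  simp only [Kk, Function.update_self, Function.update_of_ne (show m + 2 ≠ m + 1 by omega)]
  have hsin := Real.hasDerivAt_sin (q (m + 1))
  have hcos := Real.hasDerivAt_cos (q (m + 1))
  have h := ((hcos.mul_const (p (m + 2) ^ 2)).sub
    ((((hsin.const_mul 4).mul_const (Real.cos (q (m + 2)) / Real.sin (q (m + 2)))).mul_const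
      (p (m + 2))).mul_const (p (m + 1)))).sub
    (((hcos.const_mul 8).mul_const (Real.cos (q (m + 2)) ^ 2 / Real.sin (q (m + 2)) ^ 2)).mul
      (hasDerivAt_Hh_q_last p hs))
  refine h.deriv.trans ?_
  rw [Function.update_eq_self]
  ring

theorem pdp_Kk_pred (q : ℕ → ℝ) :
    pdp (m + 1) (Kk (m + 2)) q p =
      -4 * Real.sin (q (m + 1)) * (Real.cos (q (m + 2)) / Real.sin (q (m + 2))) * p (m + 2) -
      8 * Real.cos (q (m + 1)) * (Real.cos (q (m + 2)) ^ 2 / Real.sin (q (m + 2)) ^ 2) *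
        p (m + 1) := by
  simp only [pdp, Kk, Function.update_self, Function.update_of_ne (show m + 2 ≠ m + 1 by omega)]
  have h := (((hasDerivAt_id (p (m + 1))).const_mul (4 * Real.sin (q (m + 1)) *
      (Real.cos (q (m + 2)) / Real.sin (q (m + 2))) * p (m + 2))).const_sub
        (Real.cos (q (m + 1)) * p (m + 2) ^ 2)).sub
    ((hasDerivAt_Hh_p_last m q p).const_mul (8 * Real.cos (q (m + 1)) *
      (Real.cos (q (m + 2)) ^ 2 / Real.sin (q (m + 2)) ^ 2)))
  refine h.deriv.trans ?_
  ring

theorem pdq_Kk_of_ne {k : ℕ} (h1 : k ≠ m + 1) (h2 : k ≠ m + 2) (q : ℕ → ℝ) :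
    pdq k (Kk (m + 2)) q p =
      -(8 * Real.cos (q (m + 1)) * (Real.cos (q (m + 2)) ^ 2 / Real.sin (q (m + 2)) ^ 2) *
        pdq k (Hh (m + 1)) q p) := by
  simp only [pdq, Kk, Function.update_of_ne h1.symm, Function.update_of_ne h2.symm,
    deriv_const_sub, deriv_const_mul_field]

theorem pdp_Kk_of_ne {k : ℕ} (h1 : k ≠ m + 1) (h2 : k ≠ m + 2) (q : ℕ → ℝ) :
    pdp k (Kk (m + 2)) q p =
      -(8 * Real.cos (q (m + 1)) * (Real.cos (q (m + 2)) ^ 2 / Real.sin (q (m + 2)) ^ 2) *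
        pdp k (Hh (m + 1)) q p) := by
  simp only [pdp, Kk, Function.update_of_ne h1.symm, Function.update_of_ne h2.symm,
    deriv_const_sub, deriv_const_mul_field]

theorem poissonBracket_Hh_pred_Kk {N : ℕ} (hm : m + 2 ≤ N) :
    poissonBracket N (Hh (m + 1)) (Kk (m + 2)) q p =
      pdq (m + 1) (Hh (m + 1)) q p * pdp (m + 1) (Kk (m + 2)) q p -
        p (m + 1) * pdq (m + 1) (Kk (m + 2)) q p := by
  rw [poissonBracket, Finset.sum_eq_single (m + 1), pdp_Hh_self]
  · intro k _ hk
    by_cases h2 : k = m + 2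
    · rw [pdq_Hh_of_lt (by omega), pdp_Hh_of_lt (by omega)]
      ring
    · rw [pdq_Kk_of_ne p hk h2, pdp_Kk_of_ne p hk h2]
      ring
  · intro h
    simp at h
    omega

end Kk

theorem poissonBracket_Hh_Kk_self {N m : ℕ} {q p : ℕ → ℝ}
    (hs : ∀ k, 2 ≤ k → k ≤ N → Real.sin (q k) ≠ 0) (hm : m + 2 ≤ N) :
    poissonBracket N (Hh (m + 2)) (Kk (m + 2)) q p = 0 := by
  have hs1 : 2 ≤ m + 1 → Real.sin (q (m + 1)) ≠ 0 := fun h => hs _ h (by omega)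
  have hs2 := hs (m + 2) (by omega) hm
  rw [poissonBracket_Hh_succ p hm hs2, poissonBracket_Hh_pred_Kk p hm, pdq_Kk_self p hs2,
    pdp_Kk_self, pdq_Kk_pred p hs1, pdp_Kk_pred]
  have hrel := sin_mul_pdq_Hh_self p hs1
  generalize pdq (m + 1) (Hh (m + 1)) q p = D at *
  generalize Hh (m + 1) q p = L at *
  field_simp
  linear_combination
    (-16 * Real.cos (q (m + 2)) * Real.sin (q (m + 2)) * p (m + 2)) * hrel

theorem stmt_19 (N : ℕ) (hN : 2 ≤ N) (q p : ℕ → ℝ)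
    (hq : ∀ i, 2 ≤ i → i ≤ N → 0 < q i ∧ q i < π)
    (i j : ℕ) (hi : 2 ≤ i) (hij : i ≤ j) (hj : j ≤ N) :
    poissonBracket N (Hh j) (Hh i) q p = 0 ∧
    poissonBracket N (Hh j) (Kk i) q p = 0 := by
  obtain ⟨i, rfl⟩ := Nat.exists_eq_add_of_le' hi
  have hs : ∀ k, 2 ≤ k → k ≤ N → Real.sin (q k) ≠ 0 := fun k h2 hk =>
    (Real.sin_pos_of_pos_of_lt_pi (hq k h2 hk).1 (hq k h2 hk).2).ne'
  constructor
  · refine poissonBracket_Hh_eq_zero_of_le hs hi hij hj (fun k hk => pdq_Hh_of_lt hk q p)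
      (fun k hk => pdp_Hh_of_lt hk q p) ?_
    exact Finset.sum_eq_zero fun k _ => by ring
  · exact poissonBracket_Hh_eq_zero_of_le hs hi hij hj (fun k hk => pdq_Kk_of_lt hk q p)
      (fun k hk => pdp_Kk_of_lt hk q p) (poissonBracket_Hh_Kk_self hs (hij.trans hj))
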